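/- In the setting of the previous statement, the spectral invariants I_t(z) = Tr(φ(z)^t) Poisson commute for all t, t' and all spectral parameters: {I_t(z), I_{t'}(w)} = 0. -/

import Mathlib

namespace Derivation

variable {R A ι : Type*} [CommRing R] [CommRing A] [Algebra R A] [Fintype ι]

theorem map_matrix_mul (D : Derivation R A A) (M N : Matrix ι ι A) :
    (M * N).map D = M.map D * N + M * N.map D := by
  ext i j
  simp only [Matrix.map_apply, Matrix.mul_apply, Matrix.add_apply, map_sum, leibniz, smul_eq_mul,
    Finset.sum_add_distrib]
  rw [add_comm]
  congr 1
  exact Finset.sum_congr rfl fun k _ => mul_comm _ _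

variable [DecidableEq ι]

theorem trace_mul_map_pow (D : Derivation R A A) (M : Matrix ι ι A) (t : ℕ) :
    ∀ N : Matrix ι ι A, Commute N M →
      (N * (M ^ (t + 1)).map D).trace = (t + 1 : ℕ) * (N * M ^ t * M.map D).trace := by
  induction t with
  | zero => intro N _; simp
  | succ t ih =>
    intro N hN
    have h : (N * ((M ^ (t + 1)).map D * M)).trace = (M * N * (M ^ (t + 1)).map D).trace := by
      rw [← mul_assoc, Matrix.trace_mul_comm, mul_assoc]
    rw [pow_succ M (t + 1), map_matrix_mul, mul_add, Matrix.trace_add, h,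
      ih (M * N) ((Commute.refl M).mul_left hN), ← hN.eq, mul_assoc N M, ← pow_succ',
      ← mul_assoc N]
    push_cast
    ring

theorem map_trace_pow (D : Derivation R A A) (M : Matrix ι ι A) (t : ℕ) :
    D ((M ^ t).trace) = t * (M ^ (t - 1) * M.map D).trace := by
  cases t with
  | zero => simp
  | succ t =>
    have h := trace_mul_map_pow D M t 1 (Commute.one_left M)
    rw [one_mul, one_mul] at h
    rw [Nat.add_sub_cancel, ← h]
    simp [Matrix.trace, map_sum]

end Derivation

namespace Matrix

variable {A ι : Type*} [CommRing A] [Fintype ι]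

theorem trace_mul_comm_mul_left {P Q Z : Matrix ι ι A} (h : Commute P Z) :
    (Q * P * Z).trace = (P * Q * Z).trace := by
  rw [mul_assoc, h.eq, ← mul_assoc, Matrix.trace_mul_comm, mul_assoc]

theorem trace_mul_comm_mul_right {P Q W : Matrix ι ι A} (h : Commute Q W) :
    (Q * P * W).trace = (P * Q * W).trace :=
  (trace_mul_comm_mul_left h).symm

variable [DecidableEq ι]

theorem sum_mul_linear_bracket (P Q Δ : Matrix ι ι A) :
    ∑ k, ∑ l, Q k l * ∑ i, ∑ j,
        P i j * ((if i = l then Δ j k else 0) - (if k = j then Δ l i else 0)) =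
      (Q * P * Δ).trace - (P * Q * Δ).trace := by
  simp only [mul_sub, Finset.sum_sub_distrib, mul_ite, mul_zero, Finset.sum_ite_eq,
    Finset.sum_ite_irrel, Finset.sum_const_zero, Finset.sum_ite_eq', Finset.mem_univ, if_true]
  congr 1
  · simp only [Matrix.trace, Matrix.diag, Matrix.mul_apply, Finset.sum_mul, Finset.mul_sum]
    refine Finset.sum_congr rfl fun k _ => ?_
    rw [Finset.sum_comm]
    exact Finset.sum_congr rfl fun _ _ => Finset.sum_congr rfl fun _ _ => by ring
  · rw [mul_assoc, Matrix.trace_mul_comm]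
    simp only [Matrix.trace, Matrix.diag, Matrix.mul_apply, Finset.sum_mul, Finset.mul_sum]
    refine Finset.sum_congr rfl fun k _ => ?_
    rw [Finset.sum_comm]
    exact Finset.sum_congr rfl fun _ _ => Finset.sum_congr rfl fun _ _ => by ring

end Matrix


/-- For `φ(z) = Σ_m φ^m/(z − x_m)` with the linear Poisson brackets
`{(φ^m)_{ij}, (φ^{m'})_{kl}} = δ_{mm'}(δ_{jk}(φ^m)_{il} − δ_{li}(φ^m)_{kj})`, the spectral
invariants `I_t(z) = Tr(φ(z)^t)` Poisson commute: `{I_t(z), I_{t'}(w)} = 0` for all `t, t'`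
and all spectral parameters `z, w` away from the poles. -/
theorem stmt13 (A : Type*) [CommRing A] [Algebra ℂ A] (r n : ℕ)
    (B : A → A → A)
    (haddl : ∀ a b c, B (a + b) c = B a c + B b c)
    (haddr : ∀ a b c, B a (b + c) = B a b + B a c)
    (hskew : ∀ a b, B a b = - B b a)
    (hleib : ∀ a b c, B a (b * c) = B a b * c + b * B a c)
    (hsmull : ∀ (c : ℂ) (a b : A), B (c • a) b = c • B a b)
    (hsmulr : ∀ (c : ℂ) (a b : A), B a (c • b) = c • B a b)
    (φ : Fin n → Matrix (Fin r) (Fin r) A)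
    (hrel : ∀ m m' : Fin n, ∀ i j k l : Fin r,
      B (φ m i j) (φ m' k l) =
        if m = m' then
          (if j = k then φ m i l else 0) - (if l = i then φ m k j else 0)
        else 0)
    (x : Fin n → ℂ) (hx : Function.Injective x)
    (z w : ℂ) (hz : z ∉ Set.range x) (hw : w ∉ Set.range x) :
    let Φ : ℂ → Matrix (Fin r) (Fin r) A := fun u => ∑ m, ((u - x m)⁻¹ : ℂ) • φ m
    ∀ t t' : ℕ, B ((Φ z ^ t).trace) ((Φ w ^ t').trace) = 0 := by
  intro Φ t t'
  let L (a : A) : Derivation ℂ A A := Derivation.mk'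
    { toFun := B a, map_add' := haddr a, map_smul' := fun c b => hsmulr c a b }
    fun b c => by simp only [LinearMap.coe_mk, AddHom.coe_mk, hleib, smul_eq_mul]; ring
  have hL (a b : A) : L a b = B a b := rfl
  let S (b : A) : A →ₗ[ℂ] A :=
    { toFun := fun a => B a b
      map_add' := fun a c => haddl a c b
      map_smul' := fun c a => hsmull c a b }
  have hBl (c : Fin n → ℂ) (f : Fin n → A) (b : A) :
      B (∑ m, c m • f m) b = ∑ m, c m • B (f m) b := by
    have h : S b (∑ m, c m • f m) = ∑ m, c m • S b (f m) := by simp only [map_sum, map_smul]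
    exact h
  have hBr (c : Fin n → ℂ) (f : Fin n → A) (a : A) :
      B a (∑ m, c m • f m) = ∑ m, c m • B a (f m) := by
    have h : L a (∑ m, c m • f m) = ∑ m, c m • L a (f m) := by
      simp only [map_sum, Derivation.map_smul]
    exact h
  let Δ : Matrix (Fin r) (Fin r) A := ∑ m, ((z - x m)⁻¹ * (w - x m)⁻¹ : ℂ) • φ m
  have hΦ (u : ℂ) (i j : Fin r) : Φ u i j = ∑ m, ((u - x m)⁻¹ : ℂ) • φ m i j := by
    simp [Φ, Matrix.sum_apply]
  have hΔ (i j : Fin r) : Δ i j = ∑ m, ((z - x m)⁻¹ * (w - x m)⁻¹ : ℂ) • φ m i j := by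
    simp [Δ, Matrix.sum_apply]
  have hbracket (i j k l : Fin r) : B (Φ z i j) (Φ w k l) =
      (if j = k then Δ i l else 0) - (if l = i then Δ k j else 0) := by
    rw [hΦ z, hΦ w, hBl]
    simp only [hBr, hrel, smul_ite, smul_zero, Finset.sum_ite_eq, Finset.mem_univ, if_true,
      smul_smul, smul_sub, Finset.sum_sub_distrib, hΔ]
    congr 1 <;> split_ifs <;> simp
  have hentry (k l : Fin r) : B ((Φ z ^ t).trace) (Φ w k l) =
      t * ∑ i, ∑ j, (Φ z ^ (t - 1)) i j *
        ((if i = k then Δ j l else 0) - (if l = j then Δ k i else 0)) := by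
    rw [hskew, ← hL, Derivation.map_trace_pow, ← mul_neg]
    simp only [Matrix.trace, Matrix.diag, Matrix.mul_apply, Matrix.map_apply, hL,
      ← Finset.sum_neg_distrib, ← mul_neg, ← hskew, hbracket]
  have hΔ_eq : z ≠ w → Δ = (z - w)⁻¹ • (Φ w - Φ z) := by
    intro hzw
    simp only [Δ, Φ, ← Finset.sum_sub_distrib, ← sub_smul, Finset.smul_sum, smul_smul]
    refine Finset.sum_congr rfl fun m _ => ?_
    have h₁ : z - x m ≠ 0 := sub_ne_zero.2 fun h => hz ⟨m, h.symm⟩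
    have h₂ : w - x m ≠ 0 := sub_ne_zero.2 fun h => hw ⟨m, h.symm⟩
    have h₃ : z - w ≠ 0 := sub_ne_zero.2 hzw
    congr 1
    field_simp
    ring
  have hP : Commute (Φ z ^ (t - 1)) (Φ z) := (Commute.refl _).pow_left _
  have hQ : Commute (Φ w ^ (t' - 1)) (Φ w) := (Commute.refl _).pow_left _
  have htrace : (Φ w ^ (t' - 1) * Φ z ^ (t - 1) * Δ).trace =
      (Φ z ^ (t - 1) * Φ w ^ (t' - 1) * Δ).trace := by
    by_cases hzw : z = w
    · rw [hzw, ← pow_add, ← pow_add, add_comm]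
    · rw [hΔ_eq hzw, mul_smul_comm, mul_smul_comm, mul_sub, mul_sub, Matrix.trace_smul,
        Matrix.trace_smul, Matrix.trace_sub, Matrix.trace_sub,
        Matrix.trace_mul_comm_mul_left hP, Matrix.trace_mul_comm_mul_right hQ]
  have hsum : (Φ w ^ (t' - 1) * (Φ w).map (L ((Φ z ^ t).trace))).trace =
      t * ((Φ w ^ (t' - 1) * Φ z ^ (t - 1) * Δ).trace -
        (Φ z ^ (t - 1) * Φ w ^ (t' - 1) * Δ).trace) := by
    rw [← Matrix.sum_mul_linear_bracket]
    simp only [Matrix.trace, Matrix.diag, Matrix.mul_apply, Matrix.map_apply]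
    rw [Finset.mul_sum]
    refine Finset.sum_congr rfl fun k _ => ?_
    rw [Finset.mul_sum]
    refine Finset.sum_congr rfl fun l _ => ?_
    exact (congrArg _ (hentry l k)).trans (mul_left_comm _ _ _)
  rw [← hL, Derivation.map_trace_pow, hsum, htrace, sub_self, mul_zero, mul_zero]
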